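/- Fix a positive odd integer k, and for m, m' ∈ M_θ let F^{−k}_{m,m'} ∈ K be the coefficient of P_θ(m')φ̃ in the expansion of f_{−k}·P_θ(m)φ̃ given by Theorem 3.21. Set l = ε_{−k}(m) and l' = ε_{−k}(m'). Then: (a) if m' = F̃_{−k}(m), then F^{−k}_{m,m'} ∈ q^{−l}(1 + qA_0); (b) if m' ≠ F̃_{−k}(m), then ord(F^{−k}_{m,m'}) ≥ −(l + l' − 1)/2; (c) if m' ≠ F̃_{−k}(m) and ord(F^{−k}_{m,m'}) = −(l + l' − 1)/2, then both of the following hold: (1) ξ(F̃_{−k}(m)) > ξ(m'), and (2) l ≥ l' or F̃_{−k}(m) ∈ B''. -/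

import Mathlib

noncomputable section
open scoped Classical

/-- The base field `K = ℚ(q)`. -/
abbrev K : Type := RatFunc ℚ

/-- The indeterminate `q`. -/
def q : K := RatFunc.X

/-- The `q`-integer `[n]`. -/
def qint (n : ℤ) : K := (q ^ n - q ^ (-n)) / (q - q⁻¹)

/-- The subring `A_0 ⊂ K` of rational functions regular at `q = 0`. -/
def Azero : Set K := {x : K | Polynomial.eval 0 x.denom ≠ 0}

/-- `ord(a) ≥ r`, where `ord(a) = sup{n ∈ ℤ : a ∈ qⁿA_0}` (`ord 0 = ∞`). -/
def ordGE (a : K) (r : ℝ) : Prop := ∃ n : ℤ, r ≤ (n : ℝ) ∧ q ^ (-n) * a ∈ Azero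

/-- `ord(a) > r`. -/
def ordGT (a : K) (r : ℝ) : Prop := ∃ n : ℤ, r < (n : ℝ) ∧ q ^ (-n) * a ∈ Azero

/-- `ord(a) = r`. -/
def ordEQ (a : K) (r : ℝ) : Prop := ordGE a r ∧ ¬ ordGT a r

/-- `a ∈ q^l(1 + qA_0)`. -/
def inUnitBall (a : K) (l : ℤ) : Prop := ∃ b ∈ Azero, a = q ^ l * (1 + q * b)

/-- Multisegments as elements of the free abelian group on the segments `⟨i,j⟩`. -/
abbrev MS : Type := (ℤ × ℤ) →₀ ℤ

/-- The segment `⟨i,j⟩` viewed as a multisegment. -/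
def sg (i j : ℤ) : MS := Finsupp.single (i, j) 1

/-- `m` is a θ-restricted multisegment (`m_{i,j} = 0` unless `−j ≤ i ≤ j`, indices odd,
multiplicities nonnegative). -/
def IsTheta (m : MS) : Prop :=
  ∀ i j : ℤ, m (i, j) ≠ 0 → Odd i ∧ Odd j ∧ -j ≤ i ∧ i ≤ j ∧ 0 < m (i, j)

/-- `A_j^{(−k)}(m)` for a positive odd integer `k`. -/
def Aneg (k : ℤ) (m : MS) (j : ℤ) : ℤ :=
  if k < j then ∑ᶠ l : ℤ, if Odd l ∧ j ≤ l then m (-k, l) - m (-k + 2, l + 2) else 0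
  else if j = k then
    (∑ᶠ l : ℤ, if Odd l ∧ k < l then m (-k, l) - m (-k + 2, l) else 0)
      + 2 * m (-k, k) + (if Odd (m (-k + 2, k)) then 1 else 0)
  else
    (∑ᶠ l : ℤ, if Odd l ∧ k < l then m (-k, l) - m (-k + 2, l) else 0)
      + 2 * m (-k, k) - 2 * m (-k + 2, k - 2)
      + (∑ᶠ i : ℤ, if Odd i ∧ -k + 2 < i ∧ i ≤ j + 2 then m (i, k) else 0)
      - (∑ᶠ i : ℤ, if Odd i ∧ -k + 2 < i ∧ i ≤ j then m (i, k - 2) else 0)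

/-- `ε_{−k}(m) = max{A_j^{(−k)}(m) : j ≥ −k+2}`. -/
def epsNeg (k : ℤ) (m : MS) : ℤ :=
  sSup ((fun j => Aneg k m j) '' {j : ℤ | Odd j ∧ -k + 2 ≤ j})

/-- The rank function realizing the ordering `⋯ > k+2 > k > −k+2 > −k+4 > ⋯ > k−2`
on indices: `j` is larger in this ordering iff `rho k j` is larger in `ℤ`. -/
def rho (k j : ℤ) : ℤ := if k ≤ j then j else -j

/-- The index `n_f`: the smallest index (in the ordering above) attaining `ε_{−k}(m)`. -/
def nfIdx (k : ℤ) (m : MS) : ℤ :=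
  let r := sInf (rho k '' {j : ℤ | Odd j ∧ -k + 2 ≤ j ∧ Aneg k m j = epsNeg k m})
  if k ≤ r then r else -r

/-- The index `n_e`: the largest index (in the ordering above) attaining `ε_{−k}(m)`. -/
def neIdx (k : ℤ) (m : MS) : ℤ :=
  let r := sSup (rho k '' {j : ℤ | Odd j ∧ -k + 2 ≤ j ∧ Aneg k m j = epsNeg k m})
  if k ≤ r then r else -r

/-- The crystal operator `F̃_{−k}` of Definition 4.1. -/
def FtilNeg (k : ℤ) (m : MS) : MS :=
  if k < nfIdx k m then m - sg (-k + 2) (nfIdx k m) + sg (-k) (nfIdx k m)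
  else if nfIdx k m = k then
    (if Odd (m (-k + 2, k)) then m - sg (-k + 2) k + sg (-k) k
     else m - (if k ≠ 1 then sg (-k + 2) (k - 2) else 0) + sg (-k + 2) k)
  else m - (if nfIdx k m ≠ k - 2 then sg (nfIdx k m + 2) (k - 2) else 0) + sg (nfIdx k m + 2) k

/-- The crystal operator `Ẽ_{−k}` of Definition 4.1 (`none` stands for `0`). -/
def EtilNeg (k : ℤ) (m : MS) : Option MS :=
  if epsNeg k m = 0 then none
  else some (if k < neIdx k m then m - sg (-k) (neIdx k m) + sg (-k + 2) (neIdx k m)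
    else if neIdx k m = k then
      (if Odd (m (-k + 2, k)) then
        m - sg (-k + 2) k + (if k ≠ 1 then sg (-k + 2) (k - 2) else 0)
       else m - sg (-k) k + sg (-k + 2) k)
    else m - sg (neIdx k m + 2) k + (if neIdx k m ≠ k - 2 then sg (neIdx k m + 2) (k - 2) else 0))

/-- `n`-th iterate of `Ẽ_{−k}` (with `0 ↦ 0`). -/
def EtilNegIter (k : ℤ) (n : ℕ) (m : MS) : Option MS :=
  (fun o => Option.bind o (EtilNeg k))^[n] (some m)

/-- `A_j^{(k)}(m)` for a positive odd integer `k` and `j ≥ k` (Definition 3.7). -/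
def Apos (k : ℤ) (m : MS) (j : ℤ) : ℤ :=
  ∑ᶠ l : ℤ, if Odd l ∧ j ≤ l then m (k, l) - m (k + 2, l + 2) else 0

/-- `ε_k(m) = max{A_j^{(k)}(m) : j ≥ k}` for `k > 0`. -/
def epsPos (k : ℤ) (m : MS) : ℤ :=
  sSup ((fun j => Apos k m j) '' {j : ℤ | Odd j ∧ k ≤ j})

/-- The smallest `j ≥ k` attaining `ε_k(m)`. -/
def jfIdx (k : ℤ) (m : MS) : ℤ := sInf {j : ℤ | Odd j ∧ k ≤ j ∧ Apos k m j = epsPos k m}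

/-- The largest `j ≥ k` attaining `ε_k(m)`. -/
def jeIdx (k : ℤ) (m : MS) : ℤ := sSup {j : ℤ | Odd j ∧ k ≤ j ∧ Apos k m j = epsPos k m}

/-- The crystal operator `F̃_k` for `k > 0`. -/
def FtilPos (k : ℤ) (m : MS) : MS :=
  m - (if jfIdx k m ≠ k then sg (k + 2) (jfIdx k m) else 0) + sg k (jfIdx k m)

/-- The crystal operator `Ẽ_k` for `k > 0` (`none` stands for `0`). -/
def EtilPos (k : ℤ) (m : MS) : Option MS :=
  if epsPos k m = 0 then none
  else some (m - sg k (jeIdx k m) + (if jeIdx k m ≠ k then sg (k + 2) (jeIdx k m) else 0))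

/-- `ε_k(m)` for any odd `k`. -/
def eps (k : ℤ) (m : MS) : ℤ := if 0 < k then epsPos k m else epsNeg (-k) m

/-- The crystal operator `F̃_k` for any odd `k`. -/
def Ftil (k : ℤ) (m : MS) : MS := if 0 < k then FtilPos k m else FtilNeg (-k) m

/-- The crystal operator `Ẽ_k` for any odd `k`. -/
def Etil (k : ℤ) (m : MS) : Option MS := if 0 < k then EtilPos k m else EtilNeg (-k) m

/-- `n`-th iterate of `Ẽ_k` (with `0 ↦ 0`). -/
def EtilIter (k : ℤ) (n : ℕ) (m : MS) : Option MS :=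
  (fun o => Option.bind o (Etil k))^[n] (some m)


/-- The coefficient `F^{−k}_{m,m'}` of `P_θ(m')φ̃` in the expansion of
`F_{−k}·P_θ(m)φ̃` given by Theorem 3.21 of Enomoto–Kashiwara. -/
def Fco (k : ℤ) (m m' : MS) : K :=
  (∑ᶠ l : ℤ, if Odd l ∧ k < l ∧ m' = m - sg (-k + 2) l + sg (-k) l then
      qint (m (-k, l) + 1) *
        q ^ (∑ᶠ l' : ℤ, if Odd l' ∧ l < l' then m (-k + 2, l') - m (-k, l') else 0)
    else 0)
  + (if m' = m - sg (-k + 2) k + sg (-k) k then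
      qint (2 * m (-k, k) + 2) *
        q ^ (∑ᶠ l' : ℤ, if Odd l' ∧ k < l' then m (-k + 2, l') - m (-k, l') else 0)
     else 0)
  + (if m' = m - (if k ≠ 1 then sg (-k + 2) (k - 2) else 0) + sg (-k + 2) k then
      qint (m (-k + 2, k) + 1) *
        q ^ ((∑ᶠ l' : ℤ, if Odd l' ∧ k < l' then m (-k + 2, l') - m (-k, l') else 0)
             + m (-k + 2, k) - 2 * m (-k, k))
     else 0)
  + (∑ᶠ i : ℤ, if Odd i ∧ -k + 2 < i ∧ i ≤ k ∧
        m' = m - (if i ≠ k then sg i (k - 2) else 0) + sg i k then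
      qint (m (i, k) + 1) *
        q ^ ((∑ᶠ l' : ℤ, if Odd l' ∧ k < l' then m (-k + 2, l') - m (-k, l') else 0)
             + 2 * m (-k + 2, k - 2) - 2 * m (-k, k)
             + (∑ᶠ j : ℤ, if Odd j ∧ -k + 2 < j ∧ j < i then m (j, k - 2) - m (j, k) else 0))
    else 0)

/-- `ξ(m) = (−1)^{m_{−k+2,k}} m_{−k,k}`. -/
def xi (k : ℤ) (m : MS) : ℤ := (if Odd (m (-k + 2, k)) then -1 else 1) * m (-k, k)

/-- The subset `B'' ⊆ M_θ`: those `m` with `n_e(m) ∈ {−k+2, …, k−2}` (in particular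
`ε_{−k}(m) ≠ 0`) or with `m_{−k+2,k}` odd. -/
def Bpp (k : ℤ) : Set MS :=
  {m : MS | IsTheta m ∧
    ((epsNeg k m ≠ 0 ∧ -k + 2 ≤ neIdx k m ∧ neIdx k m ≤ k - 2) ∨ Odd (m (-k + 2, k)))}

theorem finite_support_row (a : ℤ) (P : ℤ → Prop) [DecidablePred P] (m : MS) :
    (Function.support fun l : ℤ => if P l then m (a, l) else 0).Finite := by
  refine (m.hasFiniteSupport.preimage (Prod.mk_right_injective a).injOn).subset fun l hl => ?_
  simp only [Function.mem_support, ne_eq, ite_eq_right_iff, Classical.not_imp] at hl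
  exact hl.2

theorem finite_support_col (b : ℤ) (P : ℤ → Prop) [DecidablePred P] (m : MS) :
    (Function.support fun i : ℤ => if P i then m (i, b) else 0).Finite := by
  refine (m.hasFiniteSupport.preimage (Prod.mk_left_injective b).injOn).subset fun i hi => ?_
  simp only [Function.mem_support, ne_eq, ite_eq_right_iff, Classical.not_imp] at hi
  exact hi.2

/-- The sum of the multiplicities `m_{a,l}` over the `l` satisfying `P`. -/
def rowSum (a : ℤ) (P : ℤ → Prop) : MS →+ ℤ where
  toFun m := ∑ᶠ l : ℤ, if P l then m (a, l) else 0
  map_zero' := by simp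
  map_add' m n := by
    rw [← finsum_add_distrib (finite_support_row a P m) (finite_support_row a P n)]
    refine finsum_congr fun l => ?_
    split_ifs <;> simp

/-- The sum of the multiplicities `m_{i,b}` over the `i` satisfying `P`. -/
def colSum (b : ℤ) (P : ℤ → Prop) : MS →+ ℤ where
  toFun m := ∑ᶠ i : ℤ, if P i then m (i, b) else 0
  map_zero' := by simp
  map_add' m n := by
    rw [← finsum_add_distrib (finite_support_col b P m) (finite_support_col b P n)]
    refine finsum_congr fun l => ?_
    split_ifs <;> simp

theorem rowSum_apply (a : ℤ) (P : ℤ → Prop) [DecidablePred P] (m : MS) :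
    rowSum a P m = ∑ᶠ l : ℤ, if P l then m (a, l) else 0 :=
  finsum_congr fun l => by congr

theorem colSum_apply (b : ℤ) (P : ℤ → Prop) [DecidablePred P] (m : MS) :
    colSum b P m = ∑ᶠ i : ℤ, if P i then m (i, b) else 0 :=
  finsum_congr fun i => by congr

theorem sg_apply (i j a b : ℤ) : sg i j (a, b) = if i = a ∧ j = b then 1 else 0 := by
  simp [sg, Finsupp.single_apply]

theorem rowSum_sg (a : ℤ) (P : ℤ → Prop) (i j : ℤ) :
    rowSum a P (sg i j) = if i = a ∧ P j then 1 else 0 := by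
  rw [rowSum_apply, finsum_eq_single _ j]
  · by_cases h : i = a <;> simp [sg_apply, h]
  · intro l hl
    simp [sg_apply, hl.symm]

theorem colSum_sg (b : ℤ) (P : ℤ → Prop) (i j : ℤ) :
    colSum b P (sg i j) = if j = b ∧ P i then 1 else 0 := by
  rw [colSum_apply, finsum_eq_single _ i]
  · by_cases h : j = b <;> simp [sg_apply, h]
  · intro l hl
    simp [sg_apply, hl.symm]

theorem rowSum_eq_add {a : ℤ} {P Q : ℤ → Prop} {j : ℤ} (h : ∀ l, P l ↔ Q l ∨ l = j)
    (hj : ¬ Q j) (m : MS) : rowSum a P m = rowSum a Q m + m (a, j) := by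
  have h1 : m (a, j) = ∑ᶠ l : ℤ, if l = j then m (a, l) else 0 := by
    rw [finsum_eq_single _ j] <;> simp +contextual
  rw [h1, rowSum_apply, rowSum_apply, ← finsum_add_distrib (finite_support_row a Q m)
    (finite_support_row a (· = j) m)]
  refine finsum_congr fun l => ?_
  by_cases hl : l = j
  · subst hl; simp [h, hj]
  · simp [h, hl]

theorem colSum_eq_add {b : ℤ} {P Q : ℤ → Prop} {j : ℤ} (h : ∀ l, P l ↔ Q l ∨ l = j)
    (hj : ¬ Q j) (m : MS) : colSum b P m = colSum b Q m + m (j, b) := by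
  have h1 : m (j, b) = ∑ᶠ l : ℤ, if l = j then m (l, b) else 0 := by
    rw [finsum_eq_single _ j] <;> simp +contextual
  rw [h1, colSum_apply, colSum_apply, ← finsum_add_distrib (finite_support_col b Q m)
    (finite_support_col b (· = j) m)]
  refine finsum_congr fun l => ?_
  by_cases hl : l = j
  · subst hl; simp [h, hj]
  · simp [h, hl]

theorem finsum_row_sub_row (a a' : ℤ) (P : ℤ → Prop) [DecidablePred P] (m : MS) :
    (∑ᶠ l : ℤ, if P l then m (a, l) - m (a', l) else 0) = rowSum a P m - rowSum a' P m := by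
  rw [rowSum_apply, rowSum_apply,
    ← finsum_sub_distrib (finite_support_row a P m) (finite_support_row a' P m)]
  exact finsum_congr fun l => by split_ifs <;> simp

theorem finsum_col_sub_col (b b' : ℤ) (P : ℤ → Prop) [DecidablePred P] (m : MS) :
    (∑ᶠ l : ℤ, if P l then m (l, b) - m (l, b') else 0) = colSum b P m - colSum b' P m := by
  rw [colSum_apply, colSum_apply,
    ← finsum_sub_distrib (finite_support_col b P m) (finite_support_col b' P m)]
  exact finsum_congr fun l => by split_ifs <;> simp

/-- The sum of `m_{a,l}` over odd `l > j`. -/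
abbrev rowTail (a j : ℤ) : MS →+ ℤ := rowSum a fun l => Odd l ∧ j < l

/-- The sum of `m_{i,b}` over odd `i` with `-k + 2 < i ≤ j`. -/
abbrev colHead (k b j : ℤ) : MS →+ ℤ := colSum b fun i => Odd i ∧ -k + 2 < i ∧ i ≤ j

theorem Aneg_of_lt {k j : ℤ} (hj : Odd j) (h : k < j) (m : MS) :
    Aneg k m j = m (-k, j) + rowTail (-k) j m - rowTail (-k + 2) j m := by
  have h1 : rowTail (-k + 2) j m
      = ∑ᶠ l : ℤ, if Odd l ∧ j ≤ l then m (-k + 2, l + 2) else 0 := by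
    rw [rowSum_apply, ← finsum_comp_equiv (Equiv.addRight (2 : ℤ))]
    refine finsum_congr fun l => ?_
    have : (Odd (l + 2) ∧ j < l + 2) ↔ (Odd l ∧ j ≤ l) := by grind
    simp only [Equiv.coe_addRight, this]
  have h2 : (Function.support fun l : ℤ =>
      if Odd l ∧ j ≤ l then m (-k + 2, l + 2) else 0).Finite := by
    have hi : Function.Injective fun l : ℤ => ((-k + 2, l + 2) : ℤ × ℤ) := fun x y hxy => by
      simpa using hxy
    refine (m.hasFiniteSupport.preimage hi.injOn).subset fun l hl => ?_
    simp only [Function.mem_support, ne_eq, ite_eq_right_iff, Classical.not_imp] at hl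
    exact hl.2
  have h3 := rowSum_eq_add (a := -k) (P := fun l => Odd l ∧ j ≤ l)
    (Q := fun l => Odd l ∧ j < l) (j := j) (by grind) (by simp) m
  rw [Aneg, if_pos h, h1, add_comm (m (-k, j)), ← h3, rowSum_apply,
    ← finsum_sub_distrib (finite_support_row (-k) _ m) h2]
  exact finsum_congr fun l => by split_ifs <;> simp

theorem Aneg_self (k : ℤ) (m : MS) :
    Aneg k m k = rowTail (-k) k m - rowTail (-k + 2) k m + 2 * m (-k, k)
      + (if Odd (m (-k + 2, k)) then 1 else 0) := by
  rw [Aneg, if_neg (lt_irrefl k), if_pos rfl, finsum_row_sub_row]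

theorem Aneg_of_gt {k j : ℤ} (h : j < k) (m : MS) :
    Aneg k m j = rowTail (-k) k m - rowTail (-k + 2) k m + 2 * m (-k, k)
      - 2 * m (-k + 2, k - 2) + colHead k k (j + 2) m - colHead k (k - 2) j m := by
  rw [Aneg, if_neg h.not_gt, if_neg h.ne, finsum_row_sub_row,
    ← colSum_apply, ← colSum_apply]

theorem exists_Aneg_eq_zero (k : ℤ) (m : MS) : ∃ N, ∀ j, N ≤ j → Aneg k m j = 0 := by
  obtain ⟨N, hN⟩ := (m.support.image Prod.snd).bddAbove
  have h0 (a b : ℤ) (hb : N < b) : m (a, b) = 0 := by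
    by_contra h
    have : b ≤ N := hN (by simpa using ⟨a, h⟩)
    omega
  refine ⟨max (N + 1) (k + 1), fun j hj => ?_⟩
  rw [Aneg, if_pos (by omega), finsum_eq_zero_of_forall_eq_zero]
  intro l
  split_ifs with h
  · rw [h0 _ _ (by omega), h0 _ _ (by omega), sub_zero]
  · rfl

theorem bddAbove_Aneg (k : ℤ) (m : MS) :
    BddAbove ((fun j => Aneg k m j) '' {j : ℤ | Odd j ∧ -k + 2 ≤ j}) := by
  obtain ⟨N, hN⟩ := exists_Aneg_eq_zero k m
  refine ((((Set.finite_Icc (-k + 2) N).image (Aneg k m)).union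
    (Set.finite_singleton 0)).bddAbove).mono ?_
  rintro _ ⟨j, ⟨-, hj⟩, rfl⟩
  rcases le_total j N with h | h
  · exact Or.inl ⟨j, ⟨hj, h⟩, rfl⟩
  · exact Or.inr (hN j h)

theorem Aneg_le_epsNeg {k : ℤ} (m : MS) {j : ℤ} (hj : Odd j) (hkj : -k + 2 ≤ j) :
    Aneg k m j ≤ epsNeg k m :=
  le_csSup (bddAbove_Aneg k m) ⟨j, ⟨hj, hkj⟩, rfl⟩

theorem exists_Aneg_eq_epsNeg {k : ℤ} (hk : Odd k) (m : MS) :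
    ∃ j, Odd j ∧ -k + 2 ≤ j ∧ Aneg k m j = epsNeg k m := by
  obtain ⟨j, ⟨h1, h2⟩, h3⟩ := Int.csSup_mem (s := (fun j => Aneg k m j) ''
    {j : ℤ | Odd j ∧ -k + 2 ≤ j}) ⟨_, -k + 2, ⟨by grind, le_rfl⟩, rfl⟩ (bddAbove_Aneg k m)
  exact ⟨j, h1, h2, h3⟩

theorem epsNeg_nonneg {k : ℤ} (m : MS) : 0 ≤ epsNeg k m := by
  obtain ⟨N, hN⟩ := exists_Aneg_eq_zero k m
  have h := hN (2 * max (max N k) (-k) + 3) (by omega)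
  rw [← h]
  exact Aneg_le_epsNeg m (by grind) (by omega)

theorem ite_rho_eq {k j : ℤ} (hkj : -k + 2 ≤ j) :
    (if k ≤ rho k j then rho k j else -rho k j) = j := by
  unfold rho
  split_ifs <;> omega

theorem nfIdx_spec {k : ℤ} (hk : Odd k) (m : MS) :
    Odd (nfIdx k m) ∧ -k + 2 ≤ nfIdx k m ∧ Aneg k m (nfIdx k m) = epsNeg k m ∧
      ∀ j, Odd j → -k + 2 ≤ j → Aneg k m j = epsNeg k m → rho k (nfIdx k m) ≤ rho k j := by
  set s := rho k '' {j : ℤ | Odd j ∧ -k + 2 ≤ j ∧ Aneg k m j = epsNeg k m} with hs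
  have hb : BddBelow s := by
    refine ⟨-k, ?_⟩
    rintro _ ⟨j, ⟨-, hj, -⟩, rfl⟩
    unfold rho
    split_ifs <;> omega
  obtain ⟨j₀, h1, h2, h3⟩ := exists_Aneg_eq_epsNeg hk m
  obtain ⟨j, ⟨h4, h5, h6⟩, h7⟩ := Int.csInf_mem (s := s) ⟨_, j₀, ⟨h1, h2, h3⟩, rfl⟩ hb
  have h8 : nfIdx k m = j := by
    rw [nfIdx, ← hs, ← h7]
    exact ite_rho_eq h5
  rw [h8]
  refine ⟨h4, h5, h6, fun j' h1 h2 h3 => ?_⟩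
  rw [h7]
  exact csInf_le hb ⟨j', ⟨h1, h2, h3⟩, rfl⟩

theorem neIdx_mem_of_Aneg_lt {k : ℤ} (hk : Odd k) (m : MS)
    (hlt : ∀ j, Odd j → k ≤ j → Aneg k m j < epsNeg k m) :
    -k + 2 ≤ neIdx k m ∧ neIdx k m ≤ k - 2 := by
  set s := rho k '' {j : ℤ | Odd j ∧ -k + 2 ≤ j ∧ Aneg k m j = epsNeg k m} with hs
  have hb : BddAbove s := by
    refine ⟨k, ?_⟩
    rintro _ ⟨j, ⟨hj0, hj, hj'⟩, rfl⟩
    have := hlt j hj0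
    unfold rho
    split_ifs <;> omega
  obtain ⟨j₀, h1, h2, h3⟩ := exists_Aneg_eq_epsNeg hk m
  obtain ⟨j, ⟨h4, h5, h6⟩, h7⟩ := Int.csSup_mem (s := s) ⟨_, j₀, ⟨h1, h2, h3⟩, rfl⟩ hb
  have h8 : neIdx k m = j := by
    rw [neIdx, ← hs, ← h7]
    exact ite_rho_eq h5
  rw [h8]
  have := hlt j h4
  grind

/-- `a` is `q ^ r` times a polynomial with constant term `1`. -/
def LeadsWith (a : K) (r : ℤ) : Prop :=
  ∃ p : Polynomial ℚ, a = q ^ r * (1 + q * algebraMap (Polynomial ℚ) K p)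

theorem q_ne_zero : q ≠ 0 := RatFunc.X_ne_zero

theorem algebraMap_mem_Azero (p : Polynomial ℚ) : algebraMap (Polynomial ℚ) K p ∈ Azero := by
  simp [Azero]

theorem LeadsWith.inUnitBall {a : K} {r : ℤ} (h : LeadsWith a r) : inUnitBall a r := by
  obtain ⟨p, hp⟩ := h
  exact ⟨_, algebraMap_mem_Azero p, hp⟩

theorem LeadsWith.zpow_mul_mem {a : K} {r : ℤ} (h : LeadsWith a r) : q ^ (-r) * a ∈ Azero := by
  obtain ⟨p, rfl⟩ := h
  rw [← mul_assoc, ← zpow_add₀ q_ne_zero, neg_add_cancel, zpow_zero, one_mul]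
  have : 1 + q * algebraMap (Polynomial ℚ) K p
      = algebraMap (Polynomial ℚ) K (1 + Polynomial.X * p) := by
    simp [q, RatFunc.algebraMap_X]
  rw [this]
  exact algebraMap_mem_Azero _

theorem LeadsWith.ordGE {a : K} {r : ℤ} (h : LeadsWith a r) {s : ℝ} (hs : s ≤ r) : ordGE a s :=
  ⟨r, hs, h.zpow_mul_mem⟩

theorem LeadsWith.le_of_ordEQ {a : K} {r : ℤ} (h : LeadsWith a r) {s : ℝ} (hs : ordEQ a s) :
    (r : ℝ) ≤ s :=
  not_lt.1 fun hlt => hs.2 ⟨r, hlt, h.zpow_mul_mem⟩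

theorem ordGE_zero (s : ℝ) : ordGE 0 s :=
  ⟨⌈s⌉, Int.le_ceil s, by simpa using algebraMap_mem_Azero 0⟩

theorem not_ordEQ_zero (s : ℝ) : ¬ ordEQ 0 s := fun h =>
  h.2 ⟨⌊s⌋ + 1, by simp, by simpa using algebraMap_mem_Azero 0⟩

theorem q_sub_inv_ne_zero : q - q⁻¹ ≠ 0 := by
  intro h
  have h1 : q * q = 1 := by
    field_simp [q_ne_zero] at h
    linear_combination h
  have h2 : (Polynomial.X * Polynomial.X : Polynomial ℚ) = 1 := by
    apply RatFunc.algebraMap_injective ℚ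
    simpa [q, RatFunc.algebraMap_X] using h1
  simpa using congrArg (Polynomial.eval 0) h2

theorem qint_add_one (n : ℕ) :
    qint (n + 1) = q ^ (-(n : ℤ)) * ∑ i ∈ Finset.range (n + 1), (q ^ 2) ^ i := by
  have hq := q_ne_zero
  have h2 : q ^ 2 - 1 ≠ 0 := by
    intro h
    apply q_sub_inv_ne_zero
    field_simp
    linear_combination h
  rw [qint, div_eq_iff q_sub_inv_ne_zero, geom_sum_eq (sub_ne_zero.1 h2)]
  have h3 : q ^ (-((n : ℤ) + 1)) = (q ^ (n + 1))⁻¹ := by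
    rw [zpow_neg]; norm_cast
  have h4 : q ^ ((n : ℤ) + 1) = q ^ (n + 1) := by norm_cast
  rw [h3, h4, zpow_neg, zpow_natCast]
  field_simp
  ring

theorem leadsWith_qint_mul (n e r : ℤ) (hn : 0 ≤ n) (hr : r = e - n) :
    LeadsWith (qint (n + 1) * q ^ e) r := by
  lift n to ℕ using hn
  subst hr
  refine ⟨∑ i ∈ Finset.range n, Polynomial.X * (Polynomial.X ^ 2) ^ i, ?_⟩
  rw [qint_add_one, Finset.sum_range_succ', sub_eq_add_neg, zpow_add₀ q_ne_zero]
  simp only [map_sum, map_mul, map_pow, RatFunc.algebraMap_X, Finset.mul_sum, ← q.eq_1]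
  have : ∀ i, q * (q * (q ^ 2) ^ i) = (q ^ 2) ^ (i + 1) := fun i => by ring
  simp only [this]
  ring

/-- Replace one segment `⟨-k+2,l⟩` by `⟨-k,l⟩`. -/
def extendRow (k l : ℤ) (m : MS) : MS := m - sg (-k + 2) l + sg (-k) l

/-- Replace one segment `⟨-k+2,k-2⟩` (empty if `k = 1`) by `⟨-k+2,k⟩`. -/
def extendCorner (k : ℤ) (m : MS) : MS :=
  m - (if k ≠ 1 then sg (-k + 2) (k - 2) else 0) + sg (-k + 2) k

/-- Replace one segment `⟨i,k-2⟩` (empty if `i = k`) by `⟨i,k⟩`. -/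
def extendCol (k i : ℤ) (m : MS) : MS := m - (if i ≠ k then sg i (k - 2) else 0) + sg i k

theorem extendRow_apply (k l a b : ℤ) (m : MS) : extendRow k l m (a, b) =
    m (a, b) - (if -k + 2 = a ∧ l = b then 1 else 0) + (if -k = a ∧ l = b then 1 else 0) := by
  simp [extendRow, sg_apply]

theorem extendCorner_apply (k a b : ℤ) (m : MS) : extendCorner k m (a, b) =
    m (a, b) - (if k ≠ 1 ∧ -k + 2 = a ∧ k - 2 = b then 1 else 0)
      + (if -k + 2 = a ∧ k = b then 1 else 0) := by
  by_cases h : k = 1 <;> simp [extendCorner, sg_apply, h]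

theorem extendCol_apply (k i a b : ℤ) (m : MS) : extendCol k i m (a, b) =
    m (a, b) - (if i ≠ k ∧ i = a ∧ k - 2 = b then 1 else 0)
      + (if i = a ∧ k = b then 1 else 0) := by
  by_cases h : i = k <;> simp [extendCol, sg_apply, h]

theorem extendRow_eq_extendRow {k l l' : ℤ} {m : MS} (h : extendRow k l m = extendRow k l' m) :
    l = l' := by
  have := DFunLike.congr_fun h (-k, l)
  rw [extendRow_apply, extendRow_apply] at this
  split_ifs at this <;> omega

theorem extendRow_ne_extendCorner {k l : ℤ} (hl : k ≤ l) {m : MS} :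
    extendRow k l m ≠ extendCorner k m := fun h => by
  have := DFunLike.congr_fun h (-k, l)
  rw [extendRow_apply, extendCorner_apply] at this
  split_ifs at this <;> omega

theorem extendRow_ne_extendCol {k l i : ℤ} (hl : k ≤ l) (hi : -k + 2 < i) {m : MS} :
    extendRow k l m ≠ extendCol k i m := fun h => by
  have := DFunLike.congr_fun h (-k, l)
  rw [extendRow_apply, extendCol_apply] at this
  split_ifs at this <;> omega

theorem extendCorner_ne_extendCol {k i : ℤ} (hi : -k + 2 < i) {m : MS} :
    extendCorner k m ≠ extendCol k i m := fun h => by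
  have := DFunLike.congr_fun h (i, k)
  rw [extendCorner_apply, extendCol_apply] at this
  split_ifs at this <;> omega

theorem extendCol_eq_extendCol {k i i' : ℤ} {m : MS} (h : extendCol k i m = extendCol k i' m) :
    i = i' := by
  have := DFunLike.congr_fun h (i, k)
  rw [extendCol_apply, extendCol_apply] at this
  split_ifs at this <;> omega

theorem Fco_eq (k : ℤ) (m m' : MS) : Fco k m m' =
    (∑ᶠ l : ℤ, if Odd l ∧ k < l ∧ m' = extendRow k l m then
      qint (m (-k, l) + 1) * q ^ (rowTail (-k + 2) l m - rowTail (-k) l m) else 0)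
    + (if m' = extendRow k k m then
      qint (2 * m (-k, k) + 2) * q ^ (rowTail (-k + 2) k m - rowTail (-k) k m) else 0)
    + (if m' = extendCorner k m then
      qint (m (-k + 2, k) + 1) *
        q ^ (rowTail (-k + 2) k m - rowTail (-k) k m + m (-k + 2, k) - 2 * m (-k, k)) else 0)
    + (∑ᶠ i : ℤ, if Odd i ∧ -k + 2 < i ∧ i ≤ k ∧ m' = extendCol k i m then
      qint (m (i, k) + 1) *
        q ^ (rowTail (-k + 2) k m - rowTail (-k) k m + 2 * m (-k + 2, k - 2) - 2 * m (-k, k)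
          + (colHead k (k - 2) (i - 2) m - colHead k k (i - 2) m)) else 0) := by
  have hcol (i : ℤ) (hi : Odd i) :
      (∑ᶠ j : ℤ, if Odd j ∧ -k + 2 < j ∧ j < i then m (j, k - 2) - m (j, k) else 0)
        = colHead k (k - 2) (i - 2) m - colHead k k (i - 2) m := by
    rw [← finsum_col_sub_col]
    refine finsum_congr fun j => ?_
    have : (Odd j ∧ -k + 2 < j ∧ j < i) ↔ (Odd j ∧ -k + 2 < j ∧ j ≤ i - 2) := by grind
    simp only [this]
  rw [Fco]
  simp only [finsum_row_sub_row]
  refine congrArg₂ _ rfl (finsum_congr fun i => ?_)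
  by_cases hi : Odd i
  · rw [hcol i hi]; rfl
  · simp [hi]

theorem eq_extend_of_Fco_ne_zero {k : ℤ} {m m' : MS} (h : Fco k m m' ≠ 0) :
    (∃ l, Odd l ∧ k < l ∧ m' = extendRow k l m) ∨ m' = extendRow k k m ∨
      m' = extendCorner k m ∨ ∃ i, Odd i ∧ -k + 2 < i ∧ i ≤ k ∧ m' = extendCol k i m := by
  contrapose! h
  obtain ⟨h1, h2, h3, h4⟩ := h
  rw [Fco_eq, if_neg h2, if_neg h3, finsum_eq_zero_of_forall_eq_zero,
    finsum_eq_zero_of_forall_eq_zero]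
  · simp
  · intro i
    rw [if_neg]
    rintro ⟨ha, hb, hc, hd⟩
    exact h4 i ha hb hc hd
  · intro i
    rw [if_neg]
    rintro ⟨ha, hb, hc⟩
    exact h1 i ha hb hc

theorem IsTheta.nonneg {m : MS} (hm : IsTheta m) (a b : ℤ) : 0 ≤ m (a, b) := by
  by_cases h : m (a, b) = 0
  · exact h.ge
  · exact (hm a b h).2.2.2.2.le

theorem leadsWith_extendRow {k l : ℤ} {m : MS} (hm : IsTheta m) (hl : Odd l) (hkl : k < l) :
    LeadsWith (Fco k m (extendRow k l m)) (-(Aneg k m l)) := by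
  have h1 : extendRow k l m ≠ extendRow k k m := fun h => hkl.ne' (extendRow_eq_extendRow h)
  rw [Fco_eq, if_neg h1, if_neg (extendRow_ne_extendCorner hkl.le), finsum_eq_single _ l,
    finsum_eq_zero_of_forall_eq_zero, if_pos ⟨hl, hkl, rfl⟩]
  · simp only [add_zero]
    refine leadsWith_qint_mul _ _ _ (hm.nonneg _ _) ?_
    rw [Aneg_of_lt hl hkl]
    ring
  · exact fun i => if_neg fun h => extendRow_ne_extendCol hkl.le h.2.1 h.2.2.2
  · exact fun l' hl' => if_neg fun h => hl' (extendRow_eq_extendRow h.2.2).symm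

theorem leadsWith_extendRow_self {k : ℤ} {m : MS} (hm : IsTheta m) :
    LeadsWith (Fco k m (extendRow k k m))
      (-(rowTail (-k) k m - rowTail (-k + 2) k m + 2 * m (-k, k) + 1)) := by
  rw [Fco_eq, if_pos rfl, if_neg (extendRow_ne_extendCorner le_rfl),
    finsum_eq_zero_of_forall_eq_zero, finsum_eq_zero_of_forall_eq_zero]
  · simp only [add_zero, zero_add]
    rw [show 2 * m (-k, k) + 2 = 2 * m (-k, k) + 1 + 1 by ring]
    refine leadsWith_qint_mul _ _ _ (by linarith [hm.nonneg (-k) k]) ?_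
    ring
  · exact fun i => if_neg fun h => extendRow_ne_extendCol le_rfl h.2.1 h.2.2.2
  · exact fun l => if_neg fun h => h.2.1.ne (extendRow_eq_extendRow h.2.2)

theorem leadsWith_extendCorner {k : ℤ} {m : MS} (hm : IsTheta m) :
    LeadsWith (Fco k m (extendCorner k m))
      (-(rowTail (-k) k m - rowTail (-k + 2) k m + 2 * m (-k, k))) := by
  rw [Fco_eq, if_pos rfl, if_neg (extendRow_ne_extendCorner le_rfl).symm,
    finsum_eq_zero_of_forall_eq_zero, finsum_eq_zero_of_forall_eq_zero]
  · simp only [add_zero, zero_add]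
    refine leadsWith_qint_mul _ _ _ (hm.nonneg _ _) ?_
    ring
  · exact fun i => if_neg fun h => extendCorner_ne_extendCol h.2.1 h.2.2.2
  · exact fun l => if_neg fun h => extendRow_ne_extendCorner h.2.1.le h.2.2.symm

theorem leadsWith_extendCol {k j : ℤ} {m : MS} (hm : IsTheta m) (hj : Odd j) (hkj : -k + 2 ≤ j)
    (hjk : j ≤ k - 2) : LeadsWith (Fco k m (extendCol k (j + 2) m)) (-(Aneg k m j)) := by
  have hi : -k + 2 < j + 2 := by omega
  have hi' : Odd (j + 2) := by grind
  rw [Fco_eq, if_neg (extendRow_ne_extendCol le_rfl hi).symm,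
    if_neg (extendCorner_ne_extendCol hi).symm, finsum_eq_zero_of_forall_eq_zero,
    finsum_eq_single _ (j + 2), if_pos ⟨hi', hi, by omega, rfl⟩]
  · simp only [add_zero, zero_add]
    refine leadsWith_qint_mul _ _ _ (hm.nonneg _ _) ?_
    have := colSum_eq_add (b := k) (P := fun i => Odd i ∧ -k + 2 < i ∧ i ≤ j + 2)
      (Q := fun i => Odd i ∧ -k + 2 < i ∧ i ≤ j) (j := j + 2) (by grind) (by simp) m
    rw [Aneg_of_gt (by omega), this, add_sub_cancel_right]
    ring
  · exact fun i h => if_neg fun h' => h (extendCol_eq_extendCol h'.2.2.2).symm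
  · exact fun l => if_neg fun h => extendRow_ne_extendCol h.2.1.le hi h.2.2.symm

theorem rowTail_extendRow (k l a j : ℤ) (m : MS) (hl : Odd l) :
    rowTail a j (extendRow k l m) = rowTail a j m - (if -k + 2 = a ∧ j < l then 1 else 0)
      + (if -k = a ∧ j < l then 1 else 0) := by
  simp [extendRow, rowSum_sg, hl]

theorem rowTail_extendCorner {k a j : ℤ} (m : MS) (h : k ≤ j) :
    rowTail a j (extendCorner k m) = rowTail a j m := by
  simp only [extendCorner, map_add, map_sub, apply_ite (rowTail a j), map_zero, rowSum_sg]
  split_ifs <;> omega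

theorem rowTail_extendCol {k i a j : ℤ} (m : MS) (h : k ≤ j) :
    rowTail a j (extendCol k i m) = rowTail a j m := by
  simp only [extendCol, map_add, map_sub, apply_ite (rowTail a j), map_zero, rowSum_sg]
  split_ifs <;> omega

theorem colHead_extendRow (k l b j : ℤ) (m : MS) :
    colHead k b j (extendRow k l m) = colHead k b j m := by
  simp only [extendRow, map_add, map_sub, colSum_sg]
  split_ifs <;> omega

theorem colHead_extendCorner (k b j : ℤ) (m : MS) :
    colHead k b j (extendCorner k m) = colHead k b j m := by
  simp only [extendCorner, map_add, map_sub, apply_ite (colHead k b j), map_zero, colSum_sg]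
  split_ifs <;> omega

theorem colHead_extendCol {k i : ℤ} (b j : ℤ) (m : MS) (hi : Odd i) (hki : -k + 2 < i) :
    colHead k b j (extendCol k i m) = colHead k b j m
      - (if i ≠ k ∧ k - 2 = b ∧ i ≤ j then 1 else 0) + (if k = b ∧ i ≤ j then 1 else 0) := by
  by_cases h : i = k
  · subst h; simp [extendCol, colSum_sg, hi, hki]
  · simp [extendCol, colSum_sg, h, hi, hki]

theorem Aneg_extendRow {k l j : ℤ} (m : MS) (hl : Odd l) (hkl : k < l) (hj : Odd j) :
    Aneg k (extendRow k l m) j = Aneg k m j + (if j < l then 2 else if j = l then 1 else 0) := by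
  rcases lt_trichotomy j k with h | rfl | h
  · simp only [Aneg_of_gt h, rowTail_extendRow _ _ _ _ _ hl, colHead_extendRow, extendRow_apply,
      true_and]
    split_ifs <;> omega
  · have h1 : extendRow j l m (-j + 2, j) = m (-j + 2, j) := by
      rw [extendRow_apply]
      split_ifs <;> omega
    have h2 : extendRow j l m (-j, j) = m (-j, j) := by
      rw [extendRow_apply]
      split_ifs <;> omega
    rw [Aneg_self, Aneg_self, h1, h2, rowTail_extendRow _ _ _ _ _ hl,
      rowTail_extendRow _ _ _ _ _ hl,
      if_pos hkl, if_neg (by omega), if_pos ⟨rfl, hkl⟩, if_pos ⟨rfl, hkl⟩, if_neg (by omega)]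
    ring
  · simp only [Aneg_of_lt hj h, rowTail_extendRow _ _ _ _ _ hl, extendRow_apply, true_and]
    split_ifs <;> omega

theorem Aneg_extendRow_self_of_lt {k j : ℤ} (m : MS) (hk : Odd k) (h : j < k) :
    Aneg k (extendRow k k m) j = Aneg k m j + 2 := by
  simp only [Aneg_of_gt h, rowTail_extendRow _ _ _ _ _ hk, colHead_extendRow, extendRow_apply,
    true_and, and_true]
  split_ifs <;> omega

theorem Aneg_extendRow_self {k : ℤ} (m : MS) (hk : Odd k) :
    Aneg k (extendRow k k m) k = Aneg k m k + (if Odd (m (-k + 2, k)) then 1 else 3) := by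
  have h : extendRow k k m (-k + 2, k) = m (-k + 2, k) - 1 := by
    rw [extendRow_apply]
    split_ifs <;> omega
  rw [Aneg_self, Aneg_self, h]
  simp only [rowTail_extendRow _ _ _ _ _ hk, extendRow_apply,
    true_and, and_true]
  split_ifs <;> grind

theorem Aneg_extendCorner_of_lt {k j : ℤ} (m : MS) (hj : -k + 2 ≤ j) (h : j < k) :
    Aneg k (extendCorner k m) j = Aneg k m j + 2 := by
  simp only [Aneg_of_gt h, rowTail_extendCorner m le_rfl, colHead_extendCorner,
    extendCorner_apply, true_and, and_true]
  split_ifs <;> omega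

theorem Aneg_extendCorner_self {k : ℤ} (m : MS) :
    Aneg k (extendCorner k m) k = Aneg k m k + (if Odd (m (-k + 2, k)) then -1 else 1) := by
  have h : extendCorner k m (-k + 2, k) = m (-k + 2, k) + 1 := by
    rw [extendCorner_apply]
    split_ifs <;> omega
  have h' : extendCorner k m (-k, k) = m (-k, k) := by
    rw [extendCorner_apply]
    split_ifs <;> omega
  rw [Aneg_self, Aneg_self, h, h']
  simp only [rowTail_extendCorner m le_rfl]
  split_ifs <;> grind

theorem Aneg_extendCol_self {k i : ℤ} (m : MS) (hki : -k + 2 < i) :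
    Aneg k (extendCol k i m) k = Aneg k m k := by
  have h1 : extendCol k i m (-k + 2, k) = m (-k + 2, k) := by
    rw [extendCol_apply]
    split_ifs <;> omega
  have h2 : extendCol k i m (-k, k) = m (-k, k) := by
    rw [extendCol_apply]
    split_ifs <;> omega
  rw [Aneg_self, Aneg_self, h1, h2, rowTail_extendCol m le_rfl, rowTail_extendCol m le_rfl]

theorem Aneg_extendCol {k i j : ℤ} (m : MS) (hk : Odd k) (hi : Odd i) (hki : -k + 2 < i)
    (hik : i ≤ k) (hj : Odd j) : Aneg k (extendCol k i m) j =
      Aneg k m j + (if k ≤ j then 0 else if i ≤ j then 2 else if i = j + 2 then 1 else 0) := by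
  rcases lt_trichotomy j k with h | rfl | h
  · have : j + 2 ≤ k := by grind
    have hij : i = j + 2 ∨ i ≤ j ∨ j + 2 < i := by grind
    have h1 : extendCol k i m (-k, k) = m (-k, k) := by
      rw [extendCol_apply]
      split_ifs <;> omega
    have h2 : extendCol k i m (-k + 2, k - 2) = m (-k + 2, k - 2) := by
      rw [extendCol_apply]
      split_ifs <;> omega
    rw [Aneg_of_gt h, Aneg_of_gt h, h1, h2, rowTail_extendCol m le_rfl,
      rowTail_extendCol m le_rfl, colHead_extendCol _ _ _ hi hki, colHead_extendCol _ _ _ hi hki,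
      if_neg h.not_ge]
    split_ifs <;> omega
  · rw [Aneg_extendCol_self m hki, if_pos le_rfl, add_zero]
  · have h1 : extendCol k i m (-k, j) = m (-k, j) := by
      rw [extendCol_apply]
      split_ifs <;> omega
    rw [Aneg_of_lt hj h, Aneg_of_lt hj h, h1, rowTail_extendCol m h.le, rowTail_extendCol m h.le,
      if_pos h.le, add_zero]

theorem FtilNeg_of_lt {k : ℤ} {m : MS} (h : k < nfIdx k m) :
    FtilNeg k m = extendRow k (nfIdx k m) m := by
  rw [FtilNeg, if_pos h, extendRow]

theorem FtilNeg_of_odd {k : ℤ} {m : MS} (h : nfIdx k m = k) (ho : Odd (m (-k + 2, k))) :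
    FtilNeg k m = extendRow k k m := by
  rw [FtilNeg, if_neg h.not_gt, if_pos h, if_pos ho, extendRow]

theorem FtilNeg_of_not_odd {k : ℤ} {m : MS} (h : nfIdx k m = k) (ho : ¬ Odd (m (-k + 2, k))) :
    FtilNeg k m = extendCorner k m := by
  rw [FtilNeg, if_neg h.not_gt, if_pos h, if_neg ho, extendCorner]

theorem FtilNeg_of_gt {k : ℤ} {m : MS} (h : nfIdx k m < k) :
    FtilNeg k m = extendCol k (nfIdx k m + 2) m := by
  have h2 : nfIdx k m ≠ k - 2 ↔ nfIdx k m + 2 ≠ k := by omega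
  rw [FtilNeg, if_neg h.not_gt, if_neg h.ne, extendCol]
  simp only [h2]

theorem leadsWith_FtilNeg {k : ℤ} (hk : Odd k) {m : MS} (hm : IsTheta m) :
    LeadsWith (Fco k m (FtilNeg k m)) (-(epsNeg k m)) := by
  obtain ⟨h1, h2, h3, -⟩ := nfIdx_spec hk m
  rw [← h3]
  rcases lt_trichotomy (nfIdx k m) k with h | h | h
  · rw [FtilNeg_of_gt h]
    exact leadsWith_extendCol hm h1 h2 (by grind)
  · by_cases ho : Odd (m (-k + 2, k))
    · rw [FtilNeg_of_odd h ho, h, Aneg_self, if_pos ho]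
      exact leadsWith_extendRow_self hm
    · rw [FtilNeg_of_not_odd h ho, h, Aneg_self, if_neg ho, add_zero]
      exact leadsWith_extendCorner hm
  · rw [FtilNeg_of_lt h]
    exact leadsWith_extendRow hm h1 h

/-- A term with leading exponent `-A_j(m)` whose target raises `A_j` by one and raises every
`A_{j'}` with `j'` before `j` by at least two satisfies the order bound, strictly unless it is
the `F̃`-term. -/
theorem order_estimate_of_index {k j : ℤ} (hk : Odd k) {m m' : MS} (hj : Odd j)
    (hkj : -k + 2 ≤ j) (hL : LeadsWith (Fco k m m') (-(Aneg k m j)))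
    (hself : Aneg k m' j = Aneg k m j + 1)
    (hlow : ∀ j', Odd j' → -k + 2 ≤ j' → rho k j' < rho k j → Aneg k m j' + 2 ≤ Aneg k m' j')
    (hF : nfIdx k m = j → m' = FtilNeg k m) (hne : m' ≠ FtilNeg k m) :
    ordGE (Fco k m m') (-((epsNeg k m : ℝ) + (epsNeg k m' : ℝ) - 1) / 2) ∧
      ¬ ordEQ (Fco k m m') (-((epsNeg k m : ℝ) + (epsNeg k m' : ℝ) - 1) / 2) := by
  have h1 := Aneg_le_epsNeg m hj hkj
  have h2 := Aneg_le_epsNeg m' hj hkj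
  constructor
  · refine hL.ordGE ?_
    have : ((2 * Aneg k m j : ℤ) : ℝ) ≤ ((epsNeg k m + epsNeg k m' - 1 : ℤ) : ℝ) := by
      exact_mod_cast (by omega)
    push_cast at this ⊢
    linarith
  · intro heq
    have h3 : ((epsNeg k m + epsNeg k m' - 1 : ℤ) : ℝ) ≤ ((2 * Aneg k m j : ℤ) : ℝ) := by
      have := hL.le_of_ordEQ heq
      push_cast at this ⊢
      linarith
    have h4 : epsNeg k m + epsNeg k m' - 1 ≤ 2 * Aneg k m j := by exact_mod_cast h3
    obtain ⟨ha, hb, hc, hd⟩ := nfIdx_spec hk m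
    have hlt : rho k (nfIdx k m) < rho k j := by
      refine lt_of_le_of_ne (hd j hj hkj (by omega)) fun h => hne (hF ?_)
      rw [← ite_rho_eq hb, h, ite_rho_eq hkj]
    have h5 := hlow _ ha hb hlt
    have h6 := Aneg_le_epsNeg m' ha hb
    omega

theorem ordGE_and_eq_of_leadsWith {a : K} {r l l' : ℤ} (hL : LeadsWith a (-r))
    (h : 2 * r ≤ l + l' - 1) :
    ordGE a (-((l : ℝ) + (l' : ℝ) - 1) / 2) ∧
      (ordEQ a (-((l : ℝ) + (l' : ℝ) - 1) / 2) → 2 * r = l + l' - 1) := by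
  have h1 : ((2 * r : ℤ) : ℝ) ≤ ((l + l' - 1 : ℤ) : ℝ) := by exact_mod_cast h
  constructor
  · refine hL.ordGE ?_
    push_cast at h1 ⊢
    linarith
  · intro heq
    have h2 : ((l + l' - 1 : ℤ) : ℝ) ≤ ((2 * r : ℤ) : ℝ) := by
      have := hL.le_of_ordEQ heq
      push_cast at this ⊢
      linarith
    exact le_antisymm h (by exact_mod_cast h2)

theorem isTheta_extendCorner {k : ℤ} (hk : Odd k) (hkpos : 0 < k) {m : MS} (hm : IsTheta m)
    (h : k ≠ 1 → 0 < m (-k + 2, k - 2)) : IsTheta (extendCorner k m) := by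
  intro a b hab
  have h0 := hm.nonneg a b
  have h1 := hm a b
  rw [extendCorner_apply] at hab ⊢
  by_cases hc : -k + 2 = a ∧ k = b
  · obtain ⟨rfl, rfl⟩ := hc
    rw [if_neg (by omega), if_pos ⟨rfl, rfl⟩]
    exact ⟨by grind, hk, by omega, by omega, by omega⟩
  · rw [if_neg hc] at hab ⊢
    by_cases hd : k ≠ 1 ∧ -k + 2 = a ∧ k - 2 = b
    · obtain ⟨hk1, rfl, rfl⟩ := hd
      rw [if_pos ⟨hk1, rfl, rfl⟩] at hab ⊢
      have := h hk1
      exact ⟨(h1 (by omega)).1, (h1 (by omega)).2.1, (h1 (by omega)).2.2.1,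
        (h1 (by omega)).2.2.2.1, by omega⟩
    · rw [if_neg hd] at hab ⊢
      simpa using h1 (by simpa using hab)

theorem isTheta_extendCol {k i : ℤ} (hk : Odd k) (hi : Odd i) (hki : -k ≤ i) (hik : i ≤ k)
    {m : MS} (hm : IsTheta m) (h : i ≠ k → 0 < m (i, k - 2)) : IsTheta (extendCol k i m) := by
  intro a b hab
  have h0 := hm.nonneg a b
  have h1 := hm a b
  rw [extendCol_apply] at hab ⊢
  by_cases hc : i = a ∧ k = b
  · obtain ⟨rfl, rfl⟩ := hc
    rw [if_neg (by omega), if_pos ⟨rfl, rfl⟩]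
    exact ⟨hi, hk, hki, hik, by omega⟩
  · rw [if_neg hc] at hab ⊢
    by_cases hd : i ≠ k ∧ i = a ∧ k - 2 = b
    · obtain ⟨hk1, rfl, rfl⟩ := hd
      rw [if_pos ⟨hk1, rfl, rfl⟩] at hab ⊢
      have := h hk1
      exact ⟨(h1 (by omega)).1, (h1 (by omega)).2.1, (h1 (by omega)).2.2.1,
        (h1 (by omega)).2.2.2.1, by omega⟩
    · rw [if_neg hd] at hab ⊢
      simpa using h1 (by simpa using hab)

theorem Aneg_lt_epsNeg_of_rho_lt {k : ℤ} (hk : Odd k) (m : MS) {j : ℤ} (hj : Odd j) (hkj : -k + 2 ≤ j)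
    (hlt : rho k j < rho k (nfIdx k m)) : Aneg k m j < epsNeg k m :=
  lt_of_le_of_ne (Aneg_le_epsNeg m hj hkj) fun h =>
    hlt.not_ge ((nfIdx_spec hk m).2.2.2 j hj hkj h)

theorem pos_of_nfIdx_eq {k : ℤ} (hk : Odd k) (hkpos : 0 < k) {m : MS} (hm : IsTheta m)
    (h : nfIdx k m = k) (ho : ¬ Odd (m (-k + 2, k))) (hk1 : k ≠ 1) :
    0 < m (-k + 2, k - 2) := by
  have hk3 : 3 ≤ k := by grind
  have h1 := Aneg_lt_epsNeg_of_rho_lt hk m (j := -k + 2) (by grind) le_rfl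
    (by rw [h]; unfold rho; split_ifs <;> omega)
  rw [← (nfIdx_spec hk m).2.2.1, h, Aneg_self, if_neg ho, Aneg_of_gt (by omega)] at h1
  have h2 : 0 ≤ colHead k k (-k + 2 + 2) m := by
    rw [colSum_apply]
    exact finsum_nonneg fun i => by split_ifs <;> simp [hm.nonneg]
  have h3 : colHead k (k - 2) (-k + 2) m = 0 := by
    rw [colSum_apply]
    exact finsum_eq_zero_of_forall_eq_zero fun i => if_neg (by omega)
  omega

theorem pos_of_nfIdx_lt {k : ℤ} (hk : Odd k) {m : MS} (hm : IsTheta m)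
    (h : nfIdx k m + 2 < k) : 0 < m (nfIdx k m + 2, k - 2) := by
  obtain ⟨hj, hkj, hA, -⟩ := nfIdx_spec hk m
  set j := nfIdx k m with hjdef
  have hj2 : Odd (j + 2) := by grind
  have h1 := Aneg_lt_epsNeg_of_rho_lt hk m hj2 (by omega)
    (by rw [← hjdef]; unfold rho; split_ifs <;> omega)
  rw [← hA, Aneg_of_gt h, Aneg_of_gt (by omega)] at h1
  have h2 : colHead k k (j + 2 + 2) m = colHead k k (j + 2) m + m (j + 2 + 2, k) :=
    colSum_eq_add (by grind) (by simp) m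
  have h3 : colHead k (k - 2) (j + 2) m = colHead k (k - 2) j m + m (j + 2, k - 2) :=
    colSum_eq_add (by grind) (by simp) m
  have h4 := hm.nonneg (j + 2 + 2) k
  omega

theorem FtilNeg_mem_Bpp {k : ℤ} (hk : Odd k) (hkpos : 0 < k) {m : MS} (hm : IsTheta m)
    (hle : nfIdx k m ≤ k) (ho : ¬ Odd (m (-k + 2, k))) : FtilNeg k m ∈ Bpp k := by
  obtain ⟨hj, hkj, hA, -⟩ := nfIdx_spec hk m
  rcases hle.lt_or_eq with h | h
  · have hj2 : nfIdx k m + 2 ≤ k := by grind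
    have hi : Odd (nfIdx k m + 2) := by grind
    rw [FtilNeg_of_gt h]
    refine ⟨isTheta_extendCol hk hi (by omega) hj2 hm fun h' => pos_of_nfIdx_lt hk hm (by omega),
      Or.inl ?_⟩
    have h1 : epsNeg k m + 1 ≤ epsNeg k (extendCol k (nfIdx k m + 2) m) := by
      have := Aneg_le_epsNeg (extendCol k (nfIdx k m + 2) m) hj hkj
      rw [Aneg_extendCol m hk hi (by omega) hj2 hj, if_neg (by omega), if_neg (by omega),
        if_pos rfl, hA] at this
      exact this
    have h0 := epsNeg_nonneg (k := k) m
    refine ⟨by omega, neIdx_mem_of_Aneg_lt hk _ fun j' hj' hkj' => ?_⟩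
    rw [Aneg_extendCol m hk hi (by omega) hj2 hj', if_pos hkj', add_zero]
    have := Aneg_le_epsNeg m hj' (show -k + 2 ≤ j' by grind)
    omega
  · rw [FtilNeg_of_not_odd h ho]
    refine ⟨isTheta_extendCorner hk hkpos hm (pos_of_nfIdx_eq hk hkpos hm h ho), Or.inr ?_⟩
    rw [extendCorner_apply, if_neg (by omega), if_pos ⟨rfl, rfl⟩]
    grind

/-- The order estimate, and what equality in it implies, for a coefficient other than the
`F̃`-term. -/
def OrderEstimate (k : ℤ) (m m' : MS) : Prop :=
  ordGE (Fco k m m') (-((epsNeg k m : ℝ) + (epsNeg k m' : ℝ) - 1) / 2) ∧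
    (ordEQ (Fco k m m') (-((epsNeg k m : ℝ) + (epsNeg k m' : ℝ) - 1) / 2) →
      xi k m' < xi k (FtilNeg k m) ∧ (epsNeg k m' ≤ epsNeg k m ∨ FtilNeg k m ∈ Bpp k))

theorem nfIdx_le_of_Aneg_eq {k : ℤ} (hk : Odd k) (hkpos : 0 < k) {m : MS}
    (h : Aneg k m k = epsNeg k m) : nfIdx k m ≤ k := by
  have h1 := (nfIdx_spec hk m).2.2.2 k hk (by grind) h
  unfold rho at h1
  split_ifs at h1 <;> omega

theorem orderEstimate_extendRow {k l : ℤ} (hk : Odd k) {m : MS} (hm : IsTheta m) (hl : Odd l)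
    (hkl : k < l) (hkpos : 0 < k) (hne : extendRow k l m ≠ FtilNeg k m) :
    OrderEstimate k m (extendRow k l m) := by
  refine (order_estimate_of_index hk hl (by omega) (leadsWith_extendRow hm hl hkl) ?_ ?_ ?_
    hne).imp_right fun h h' => absurd h' h
  · rw [Aneg_extendRow m hl hkl hl, if_neg (lt_irrefl l), if_pos rfl]
  · intro j hj hkj hlt
    rw [Aneg_extendRow m hl hkl hj, if_pos]
    unfold rho at hlt
    split_ifs at hlt <;> omega
  · rintro rfl
    exact (FtilNeg_of_lt hkl).symm

theorem orderEstimate_extendCol {k j : ℤ} (hk : Odd k) {m : MS} (hm : IsTheta m) (hj : Odd j)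
    (hkj : -k + 2 ≤ j) (hjk : j ≤ k - 2) (hne : extendCol k (j + 2) m ≠ FtilNeg k m) :
    OrderEstimate k m (extendCol k (j + 2) m) := by
  have hj2 : Odd (j + 2) := by grind
  refine (order_estimate_of_index hk hj hkj (leadsWith_extendCol hm hj hkj hjk) ?_ ?_ ?_
    hne).imp_right fun h h' => absurd h' h
  · rw [Aneg_extendCol m hk hj2 (by omega) (by omega) hj, if_neg (by omega), if_neg (by omega),
      if_pos rfl]
  · intro j' hj' hkj' hlt
    have : j < j' → j + 2 ≤ j' := by grind
    unfold rho at hlt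
    rw [Aneg_extendCol m hk hj2 (by omega) (by omega) hj', if_neg, if_pos]
    · split_ifs at hlt <;> omega
    · split_ifs at hlt <;> omega
  · rintro rfl
    exact (FtilNeg_of_gt (by omega)).symm

theorem orderEstimate_extendRow_self {k : ℤ} (hk : Odd k) (hkpos : 0 < k) {m : MS}
    (hm : IsTheta m) (hne : extendRow k k m ≠ FtilNeg k m) :
    OrderEstimate k m (extendRow k k m) := by
  have hkk : -k + 2 ≤ k := by grind
  have hL := leadsWith_extendRow_self (k := k) hm
  have hself := Aneg_extendRow_self m hk
  by_cases ho : Odd (m (-k + 2, k))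
  · rw [if_pos ho] at hself
    refine (order_estimate_of_index hk hk hkk ?_ hself ?_ ?_ hne).imp_right
      fun h h' => absurd h' h
    · rwa [Aneg_self, if_pos ho]
    · intro j hj hkj hlt
      rw [Aneg_extendRow_self_of_lt m hk]
      unfold rho at hlt
      split_ifs at hlt <;> omega
    · exact fun h => (FtilNeg_of_odd h ho).symm
  · rw [if_neg ho] at hself
    have hA : Aneg k m k = rowTail (-k) k m - rowTail (-k + 2) k m + 2 * m (-k, k) := by
      rw [Aneg_self, if_neg ho, add_zero]
    rw [← hA] at hL
    have h1 := Aneg_le_epsNeg m hk hkk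
    have h2 := Aneg_le_epsNeg (extendRow k k m) hk hkk
    refine (ordGE_and_eq_of_leadsWith hL (by omega)).imp_right fun h heq => ?_
    have h3 := h heq
    have hle := nfIdx_le_of_Aneg_eq hk hkpos (show Aneg k m k = epsNeg k m by omega)
    refine ⟨?_, Or.inr (FtilNeg_mem_Bpp hk hkpos hm hle ho)⟩
    have h4 := hm.nonneg (-k) k
    have h5 : extendRow k k m (-k + 2, k) = m (-k + 2, k) - 1 := by
      rw [extendRow_apply]
      split_ifs <;> omega
    have h6 : extendRow k k m (-k, k) = m (-k, k) + 1 := by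
      rw [extendRow_apply]
      split_ifs <;> omega
    have h7 : FtilNeg k m (-k, k) = m (-k, k) := by
      rcases hle.lt_or_eq with h | h
      · rw [FtilNeg_of_gt h, extendCol_apply]
        have := (nfIdx_spec hk m).2.1
        split_ifs <;> omega
      · rw [FtilNeg_of_not_odd h ho, extendCorner_apply]
        split_ifs <;> omega
    unfold xi
    rw [h5, h6, h7, if_pos (by grind)]
    split_ifs <;> omega

theorem orderEstimate_extendCorner {k : ℤ} (hk : Odd k) (hkpos : 0 < k) {m : MS}
    (hm : IsTheta m) (hne : extendCorner k m ≠ FtilNeg k m) :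
    OrderEstimate k m (extendCorner k m) := by
  have hkk : -k + 2 ≤ k := by grind
  have hL := leadsWith_extendCorner (k := k) hm
  have hself := Aneg_extendCorner_self (k := k) m
  by_cases ho : Odd (m (-k + 2, k))
  · rw [if_pos ho] at hself
    have hA : Aneg k m k - 1 = rowTail (-k) k m - rowTail (-k + 2) k m + 2 * m (-k, k) := by
      rw [Aneg_self, if_pos ho]
      ring
    rw [← hA] at hL
    have h1 := Aneg_le_epsNeg m hk hkk
    have h2 := Aneg_le_epsNeg (extendCorner k m) hk hkk
    refine (ordGE_and_eq_of_leadsWith hL (by omega)).imp_right fun h heq => ?_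
    have h3 := h heq
    have hle := nfIdx_le_of_Aneg_eq hk hkpos (show Aneg k m k = epsNeg k m by omega)
    refine ⟨?_, Or.inl (by omega)⟩
    obtain ⟨hj, hkj, hj', -⟩ := nfIdx_spec hk m
    rcases hle.lt_or_eq with h | h
    · have h4 := Aneg_le_epsNeg (extendCorner k m) hj hkj
      rw [Aneg_extendCorner_of_lt m hkj h] at h4
      omega
    · have h5 : extendCorner k m (-k + 2, k) = m (-k + 2, k) + 1 := by
        rw [extendCorner_apply]
        split_ifs <;> omega
      have h6 : extendCorner k m (-k, k) = m (-k, k) := by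
        rw [extendCorner_apply]
        split_ifs <;> omega
      have h7 : extendRow k k m (-k + 2, k) = m (-k + 2, k) - 1 := by
        rw [extendRow_apply]
        split_ifs <;> omega
      have h8 : extendRow k k m (-k, k) = m (-k, k) + 1 := by
        rw [extendRow_apply]
        split_ifs <;> omega
      rw [FtilNeg_of_odd h ho]
      unfold xi
      rw [h5, h6, h7, h8, if_neg (by grind), if_neg (by grind)]
      omega
  · rw [if_neg ho] at hself
    refine (order_estimate_of_index hk hk hkk ?_ hself ?_ ?_ hne).imp_right
      fun h h' => absurd h' h
    · rwa [Aneg_self, if_neg ho, add_zero]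
    · intro j hj hkj hlt
      rw [Aneg_extendCorner_of_lt m hkj]
      unfold rho at hlt
      split_ifs at hlt <;> omega
    · exact fun h => (FtilNeg_of_not_odd h ho).symm

theorem orderEstimate {k : ℤ} (hk : Odd k) (hkpos : 0 < k) {m m' : MS} (hm : IsTheta m)
    (hne : m' ≠ FtilNeg k m) : OrderEstimate k m m' := by
  by_cases h0 : Fco k m m' = 0
  · rw [OrderEstimate, h0]
    exact ⟨ordGE_zero _, fun h => absurd h (not_ordEQ_zero _)⟩
  · rcases eq_extend_of_Fco_ne_zero h0 with ⟨l, hl, hkl, rfl⟩ | rfl | rfl | ⟨i, hi, hki, hik, rfl⟩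
    · exact orderEstimate_extendRow hk hm hl hkl hkpos hne
    · exact orderEstimate_extendRow_self hk hkpos hm hne
    · exact orderEstimate_extendCorner hk hkpos hm hne
    · have hi2 : i = i - 2 + 2 := by ring
      rw [hi2] at hne ⊢
      exact orderEstimate_extendCol hk hm (by grind) (by grind) (by omega) hne

/-- Proposition 4.12 of Enomoto–Kashiwara: order estimates for the coefficients
`F^{−k}_{m,m'}`.  Here `l = ε_{−k}(m)` and `l' = ε_{−k}(m')`. -/
theorem F_coefficient_estimates (k : ℤ) (hk : Odd k) (hkpos : 0 < k)
    (m m' : MS) (hm : IsTheta m) (hm' : IsTheta m') :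
    (m' = FtilNeg k m → inUnitBall (Fco k m m') (-(epsNeg k m))) ∧
    (m' ≠ FtilNeg k m →
      ordGE (Fco k m m') (-((epsNeg k m : ℝ) + (epsNeg k m' : ℝ) - 1) / 2)) ∧
    (m' ≠ FtilNeg k m →
      ordEQ (Fco k m m') (-((epsNeg k m : ℝ) + (epsNeg k m' : ℝ) - 1) / 2) →
      xi k m' < xi k (FtilNeg k m) ∧
        (epsNeg k m' ≤ epsNeg k m ∨ FtilNeg k m ∈ Bpp k)) := by
  refine ⟨?_, fun h => (orderEstimate hk hkpos hm h).1, fun h => (orderEstimate hk hkpos hm h).2⟩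
  rintro rfl
  exact (leadsWith_FtilNeg hk hm).inUnitBall

end
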